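/- For every s ∈ ℂ^{μ_A−1} and every s_μ ∈ ℂ∖{0}, the residue classes of the μ_A polynomials 1, x_i^j (for i = 1,2,3 and 1 ≤ j ≤ a_i−1), and s_μ^{−1}·x_1x_2x_3 form a ℂ-basis of the Jacobian ring ℂ[x_1,x_2,x_3]/(∂F/∂x_1, ∂F/∂x_2, ∂F/∂x_3), where F(x) := F_A(x; s, s_μ). -/

import Mathlib

open MvPolynomial

/-- The universal unfolding `F_A` of the affine cusp polynomial of type
`A = (a 0, a 1, a 2)`. -/
noncomputable def cuspUnfolding (a : Fin 3 → ℕ) (s1 : ℂ) (sij : Fin 3 → ℕ → ℂ) (sμ : ℂ) :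
    MvPolynomial (Fin 3) ℂ :=
  (∑ i, X i ^ a i) - C sμ⁻¹ * (X 0 * X 1 * X 2) + C s1
    + ∑ i, ∑ j ∈ Finset.Ico 1 (a i), C (sij i j) * X i ^ j

/-- The Jacobian ideal `(∂F/∂x₁, ∂F/∂x₂, ∂F/∂x₃)`. -/
noncomputable def jacobianIdeal (F : MvPolynomial (Fin 3) ℂ) : Ideal (MvPolynomial (Fin 3) ℂ) :=
  Ideal.span (Set.range fun i : Fin 3 => pderiv i F)

/-- Index type of cardinality `μ_A = a₁ + a₂ + a₃ − 1`, indexing the monomials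
`1`, `xᵢʲ` (`i = 1,2,3`, `1 ≤ j ≤ aᵢ − 1`) and `s_μ⁻¹ x₁x₂x₃`. -/
abbrev MuIdx (a : Fin 3 → ℕ) : Type :=
  Unit ⊕ ((Σ i : Fin 3, {j : ℕ // j ∈ Finset.Ico 1 (a i)}) ⊕ Unit)

/-- The family of residue classes of `1`, `xᵢʲ`, `s_μ⁻¹ x₁x₂x₃` in the Jacobian ring. -/
noncomputable def jacFam (a : Fin 3 → ℕ) (s1 : ℂ) (sij : Fin 3 → ℕ → ℂ) (sμ : ℂ) :
    MuIdx a → MvPolynomial (Fin 3) ℂ ⧸ jacobianIdeal (cuspUnfolding a s1 sij sμ) := fun k =>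
  Ideal.Quotient.mk (jacobianIdeal (cuspUnfolding a s1 sij sμ)) <|
    match k with
    | Sum.inl _ => 1
    | Sum.inr (Sum.inl ⟨i, j⟩) => X i ^ (j : ℕ)
    | Sum.inr (Sum.inr _) => C sμ⁻¹ * (X 0 * X 1 * X 2)

open Finsupp (weight single)

namespace MvPolynomial

section LeadingMonomials

variable {σ k : Type*} [Field k] (w : σ → ℕ)

/-- Polynomials all of whose monomials have `w`-weight less than `n`. -/
noncomputable def weightLT (k : Type*) [Field k] (n : ℕ) : Submodule k (MvPolynomial σ k) :=
  restrictSupport k {m | weight w m < n}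

/-- `p` is a nonzero multiple of the monomial `m` up to terms of strictly smaller weight. -/
def HasLead (p : MvPolynomial σ k) (m : σ →₀ ℕ) : Prop :=
  ∃ α : k, α ≠ 0 ∧ p - monomial m α ∈ weightLT w k (weight w m)

variable {w}

lemma monomial_mem_weightLT {m : σ →₀ ℕ} {n : ℕ} (h : weight w m < n) (r : k) :
    monomial m r ∈ weightLT w k n := by
  rw [weightLT, monomial_mem_restrictSupport]
  exact Or.inl h

lemma weightLT_mono {a b : ℕ} (h : a ≤ b) : weightLT w k a ≤ weightLT w k b :=
  restrictSupport_mono k fun _ hm => lt_of_lt_of_le hm h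

lemma coeff_eq_zero_of_mem_weightLT {p : MvPolynomial σ k} {n : ℕ} (hp : p ∈ weightLT w k n)
    {m : σ →₀ ℕ} (hm : n ≤ weight w m) : coeff m p = 0 := by
  by_contra h
  exact absurd ((mem_restrictSupport_iff k).mp hp (mem_support_iff.mpr h)) (not_lt.mpr hm)

lemma mul_mem_weightLT {a b : ℕ} {p q : MvPolynomial σ k} (hp : p ∈ weightLT w k (a + 1))
    (hq : q ∈ weightLT w k b) : p * q ∈ weightLT w k (a + b) := by
  have h := Submodule.mul_mem_mul hp hq
  rw [weightLT, weightLT, ← restrictSupport_add] at h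
  refine restrictSupport_mono k ?_ h
  rintro _ ⟨x, hx, y, hy, rfl⟩
  simp only [Set.mem_ofPred_eq, map_add] at *
  omega

lemma monomial_mul_mem_weightLT {b : ℕ} (m : σ →₀ ℕ) (r : k) {q : MvPolynomial σ k}
    (hq : q ∈ weightLT w k b) : monomial m r * q ∈ weightLT w k (weight w m + b) :=
  mul_mem_weightLT (monomial_mem_weightLT (Nat.lt_succ_self _) r) hq

lemma HasLead.monomial_mul_left {p : MvPolynomial σ k} {m : σ →₀ ℕ} (h : HasLead w p m)
    (d : σ →₀ ℕ) : HasLead w (monomial d 1 * p) (d + m) := by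
  obtain ⟨α, hα, hp⟩ := h
  refine ⟨α, hα, ?_⟩
  have := monomial_mul_mem_weightLT d (1 : k) hp
  rwa [mul_sub, monomial_mul, one_mul, ← map_add] at this

lemma HasLead.add {p q : MvPolynomial σ k} {m : σ →₀ ℕ} (h : HasLead w p m)
    (hq : q ∈ weightLT w k (weight w m)) : HasLead w (p + q) m := by
  obtain ⟨α, hα, hp⟩ := h
  exact ⟨α, hα, by simpa [add_sub_right_comm] using add_mem hp hq⟩

lemma HasLead.sub {p q : MvPolynomial σ k} {m : σ →₀ ℕ} (h : HasLead w p m)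
    (hq : q ∈ weightLT w k (weight w m)) : HasLead w (p - q) m := by
  simpa [sub_eq_add_neg] using h.add (neg_mem hq)

lemma HasLead.const_mul {p : MvPolynomial σ k} {m : σ →₀ ℕ} (h : HasLead w p m) {c : k}
    (hc : c ≠ 0) : HasLead w (C c * p) m := by
  obtain ⟨α, hα, hp⟩ := h
  refine ⟨c * α, mul_ne_zero hc hα, ?_⟩
  have := Submodule.smul_mem _ c hp
  rwa [smul_eq_C_mul, mul_sub, C_mul_monomial] at this

lemma HasLead.neg {p : MvPolynomial σ k} {m : σ →₀ ℕ} (h : HasLead w p m) :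
    HasLead w (-p) m := by
  simpa using h.const_mul (c := -1) (by simp)

lemma HasLead.mem_weightLT {p : MvPolynomial σ k} {m : σ →₀ ℕ} (h : HasLead w p m) {n : ℕ}
    (hn : weight w m < n) : p ∈ weightLT w k n := by
  obtain ⟨α, hα, hp⟩ := h
  simpa using add_mem (weightLT_mono hn.le hp) (monomial_mem_weightLT hn α)

lemma hasLead_monomial (m : σ →₀ ℕ) {r : k} (hr : r ≠ 0) : HasLead w (monomial m r) m :=
  ⟨r, hr, by simp⟩

/-- A family of polynomials with prescribed, pairwise distinct leading monomials is linearly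
independent. -/
lemma linearIndependent_of_hasLead {b : (σ →₀ ℕ) → MvPolynomial σ k}
    (hb : ∀ m, HasLead w (b m) m) : LinearIndependent k b := by
  classical
  rw [linearIndependent_iff]
  intro l hl
  by_contra hne
  obtain ⟨m, hm, hmax⟩ := Finset.exists_max_image l.support (fun m => weight w m)
    (Finsupp.support_nonempty_iff.mpr hne)
  obtain ⟨α, hα, hp⟩ := hb m
  have hself : coeff m (b m) = α := by
    have := coeff_eq_zero_of_mem_weightLT hp le_rfl
    rwa [coeff_sub, coeff_monomial, if_pos rfl, sub_eq_zero] at this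
  have hcoeff := congrArg (coeff m) hl
  rw [Finsupp.linearCombination_apply, Finsupp.sum, coeff_sum,
    Finset.sum_eq_single_of_mem m hm] at hcoeff
  · rw [coeff_smul, hself, coeff_zero, smul_eq_mul] at hcoeff
    exact mul_ne_zero (Finsupp.mem_support_iff.mp hm) hα hcoeff
  · intro m' hm' hne'
    obtain ⟨β, -, hp'⟩ := hb m'
    have := coeff_eq_zero_of_mem_weightLT hp' (hmax m' hm')
    rw [coeff_sub, coeff_monomial, if_neg hne', sub_zero] at this
    rw [coeff_smul, this, smul_zero]

/-- A family of polynomials with every monomial as a leading monomial spans. -/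
lemma span_eq_top_of_hasLead {b : (σ →₀ ℕ) → MvPolynomial σ k}
    (hb : ∀ m, HasLead w (b m) m) : Submodule.span k (Set.range b) = ⊤ := by
  have hlt : ∀ n, weightLT w k n ≤ Submodule.span k (Set.range b) := by
    intro n
    induction n with
    | zero => simp [weightLT, restrictSupport_eq_span]
    | succ n ih =>
      rw [weightLT, restrictSupport_eq_span, Submodule.span_le, Set.image_subset_iff]
      intro m hm
      obtain ⟨α, hα, hp⟩ := hb m
      have h1 := ih (weightLT_mono (Nat.lt_succ_iff.mp hm) hp)
      have h2 := Submodule.smul_mem _ α⁻¹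
        (sub_mem (Submodule.subset_span (Set.mem_range_self m)) h1)
      simpa [smul_monomial, hα] using h2
  rw [eq_top_iff]
  intro p _
  induction p using MvPolynomial.induction_on' with
  | monomial m r => exact hlt _ (monomial_mem_weightLT (Nat.lt_succ_self _) r)
  | add p q hp hq => exact add_mem (hp trivial) (hq trivial)

end LeadingMonomials

section CuspRewriting

variable {k : Type*} [Field k] (d : Fin 3 → ℕ) (c : k) (q : Fin 3 → MvPolynomial (Fin 3) k)

/-- The polynomials `q i - c * x j * x l` with `{i, j, l} = {0, 1, 2}`. -/
noncomputable def cuspPartial : Fin 3 → MvPolynomial (Fin 3) k :=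
  ![q 0 - C c * (X 1 * X 2), q 1 - C c * (X 0 * X 2), q 2 - C c * (X 0 * X 1)]

/-- The difference of the `i`-th and the last Euler terms `x i * q i`. -/
noncomputable def eulerDiff (i : Fin 3) : MvPolynomial (Fin 3) k := X i * q i - X 2 * q 2

/-- The relation whose leading monomial is a power of the last variable. -/
noncomputable def apexRel : MvPolynomial (Fin 3) k := q 0 * q 1 - C c * (X 2 ^ 2 * q 2)

/-- The exponents of the monomials outside the leading ideal of the Jacobian ideal. -/
def cuspStd : Set (Fin 3 →₀ ℕ) :=
  {m | ¬(1 ≤ m 1 ∧ 1 ≤ m 2) ∧ ¬(1 ≤ m 0 ∧ 1 ≤ m 2) ∧ ¬(1 ≤ m 0 ∧ 1 ≤ m 1) ∧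
    ¬(d 0 + 1 ≤ m 0) ∧ ¬(d 1 + 1 ≤ m 1) ∧ ¬(d 2 + 2 ≤ m 2)}

/-- A basis of the polynomial ring adapted to the Jacobian ideal: the member with leading monomial
`m` lies in the ideal unless `m` is a standard monomial. -/
noncomputable def cuspFam (m : Fin 3 →₀ ℕ) : MvPolynomial (Fin 3) k :=
  if 1 ≤ m 1 ∧ 1 ≤ m 2 then monomial (m - (single 1 1 + single 2 1)) 1 * cuspPartial c q 0
  else if 1 ≤ m 0 ∧ 1 ≤ m 2 then monomial (m - (single 0 1 + single 2 1)) 1 * cuspPartial c q 1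
  else if 1 ≤ m 0 ∧ 1 ≤ m 1 then monomial (m - (single 0 1 + single 1 1)) 1 * cuspPartial c q 2
  else if d 0 + 1 ≤ m 0 then monomial (m - single 0 (d 0 + 1)) 1 * eulerDiff q 0
  else if d 1 + 1 ≤ m 1 then monomial (m - single 1 (d 1 + 1)) 1 * eulerDiff q 1
  else if d 2 + 2 ≤ m 2 then monomial (m - single 2 (d 2 + 2)) 1 * apexRel c q
  else if m = single 2 (d 2 + 1) then X 2 * q 2
  else monomial m 1

/-- The span of the members of `cuspFam` with nonstandard leading monomial. -/
noncomputable def cuspSpan : Submodule k (MvPolynomial (Fin 3) k) :=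
  Submodule.span k (cuspFam d c q '' (cuspStd d)ᶜ)

/-- Weights for which `x i * x j` dominates each cusp partial derivative and the last Euler term is
dominated by the other two. -/
structure CuspWeight (d w : Fin 3 → ℕ) : Prop where
  lt_zero : (d 2 + 1) * w 2 < (d 0 + 1) * w 0
  lt_one : (d 2 + 1) * w 2 < (d 1 + 1) * w 1
  lt_sum : (d 0 + 1) * w 0 + (d 1 + 1) * w 1 < w 0 + w 1 + w 2 + (d 2 + 1) * w 2

variable {d c q} {w : Fin 3 → ℕ}

lemma hasLead_X_mul {p : MvPolynomial (Fin 3) k} {i : Fin 3} {n : ℕ}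
    (h : HasLead w p (single i n)) : HasLead w (X i * p) (single i (n + 1)) := by
  simpa [X, add_comm, ← Finsupp.single_add] using h.monomial_mul_left (single i 1)

lemma hasLead_sub_mul_X_mul_X {p : MvPolynomial (Fin 3) k} (hc : c ≠ 0) (i j : Fin 3)
    (h : p ∈ weightLT w k (w i + w j)) :
    HasLead w (p - C c * (X i * X j)) (single i 1 + single j 1) := by
  have h1 : HasLead w (monomial (single i 1 + single j 1) c) (single i 1 + single j 1) :=
    hasLead_monomial _ hc
  have h2 := (h1.sub (q := p) (by simpa [Finsupp.weight_single] using h)).neg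
  have h3 : monomial (single i 1 + single j 1) c = C c * (X i * X j) := by
    simp [X, C_mul_monomial, monomial_mul]
  rwa [h3, neg_sub] at h2

lemma single_add_single_le {m : Fin 3 →₀ ℕ} {i j : Fin 3} (hij : i ≠ j) (hi : 1 ≤ m i)
    (hj : 1 ≤ m j) : single i 1 + single j 1 ≤ m := by
  intro l
  by_cases h : i = l
  · subst h; simpa [hij.symm] using hi
  · by_cases h' : j = l
    · subst h'; simpa [h] using hj
    · simp [h, h']

lemma hasLead_cuspFam (hw : CuspWeight d w) (hc : c ≠ 0)
    (hq : ∀ i, HasLead w (q i) (single i (d i))) (m : Fin 3 →₀ ℕ) :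
    HasLead w (cuspFam d c q m) m := by
  obtain ⟨h0, h1, h2⟩ := hw
  have hqw : ∀ i, ∀ n, d i * w i < n → q i ∈ weightLT w k n := fun i n hn =>
    (hq i).mem_weightLT (by simpa [Finsupp.weight_single] using hn)
  have aux : ∀ {p : MvPolynomial (Fin 3) k} {e : Fin 3 →₀ ℕ}, HasLead w p e → e ≤ m →
      HasLead w (monomial (m - e) 1 * p) m := fun {p e} hp he => by
    have := hp.monomial_mul_left (m - e)
    rwa [tsub_add_cancel_of_le he] at this
  have hE : ∀ i, HasLead w (X i * q i) (single i (d i + 1)) := fun i => hasLead_X_mul (hq i)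
  unfold cuspFam
  split_ifs with c1 c2 c3 c4 c5 c6 c7
  · exact aux (hasLead_sub_mul_X_mul_X hc 1 2 (hqw 0 _ (by linarith)))
      (single_add_single_le (by decide) c1.1 c1.2)
  · exact aux (hasLead_sub_mul_X_mul_X hc 0 2 (hqw 1 _ (by linarith)))
      (single_add_single_le (by decide) c2.1 c2.2)
  · exact aux (hasLead_sub_mul_X_mul_X hc 0 1 (hqw 2 _ (by linarith)))
      (single_add_single_le (by decide) c3.1 c3.2)
  · refine aux ((hE 0).sub ((hE 2).mem_weightLT ?_)) (Finsupp.single_le_iff.mpr c4)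
    simpa only [Finsupp.weight_single, smul_eq_mul] using h0
  · refine aux ((hE 1).sub ((hE 2).mem_weightLT ?_)) (Finsupp.single_le_iff.mpr c5)
    simpa only [Finsupp.weight_single, smul_eq_mul] using h1
  · refine aux ?_ (Finsupp.single_le_iff.mpr c6)
    have hlead := ((hasLead_X_mul (hE 2)).const_mul hc).sub (q := q 0 * q 1) ?_
    · have := hlead.neg
      rwa [neg_sub, ← mul_assoc (X 2), ← sq] at this
    · refine weightLT_mono ?_ (mul_mem_weightLT (hqw 0 _ (Nat.lt_succ_self _))
        (hqw 1 _ (Nat.lt_succ_self _)))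
      simp only [Finsupp.weight_single, smul_eq_mul]
      linarith
  · rw [c7]; exact hE 2
  · exact hasLead_monomial m one_ne_zero

lemma cuspFam_mem_cuspSpan {m : Fin 3 →₀ ℕ} (hm : m ∉ cuspStd d) :
    cuspFam d c q m ∈ cuspSpan d c q :=
  Submodule.subset_span (Set.mem_image_of_mem _ hm)

lemma mul_mem_of_forall_monomial_mul_mem {σ : Type*} {w : σ → ℕ}
    {K : Submodule k (MvPolynomial σ k)} {f g : MvPolynomial σ k} {n : ℕ}
    (hg : g ∈ weightLT w k n) (h : ∀ m, weight w m < n → monomial m 1 * f ∈ K) : g * f ∈ K := by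
  rw [weightLT, restrictSupport_eq_span] at hg
  induction hg using Submodule.span_induction with
  | mem x hx =>
    obtain ⟨m, hm, rfl⟩ := hx
    exact h m hm
  | zero => simp
  | add x y _ _ hx hy => rw [add_mul]; exact add_mem hx hy
  | smul r x _ hx => rw [smul_mul_assoc]; exact Submodule.smul_mem _ r hx

lemma monomial_eq_mul_X {m : Fin 3 →₀ ℕ} {i : Fin 3} (h : m i ≠ 0) :
    ∃ m', weight w m = weight w m' + w i ∧ monomial m (1 : k) = monomial m' 1 * X i := by
  refine ⟨m - single i 1, ?_, ?_⟩
  · exact (Finsupp.weight_sub_single_add h).symm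
  · rw [X, monomial_mul, one_mul,
      tsub_add_cancel_of_le (Finsupp.single_le_iff.mpr (Nat.one_le_iff_ne_zero.mpr h))]

/-- All monomial multiples of `f` of total weight less than `n` lie in `K`, where `f` is assigned
the weight `l`. -/
def MulMemBelow (w : Fin 3 → ℕ) (K : Submodule k (MvPolynomial (Fin 3) k))
    (f : MvPolynomial (Fin 3) k) (l n : ℕ) : Prop :=
  ∀ m, weight w m + l < n → monomial m 1 * f ∈ K

lemma MulMemBelow.monomial_mul_mul_mem {K : Submodule k (MvPolynomial (Fin 3) k)}
    {f g : MvPolynomial (Fin 3) k} {l n : ℕ} (h : MulMemBelow w K f l n) {r : ℕ}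
    (hg : g ∈ weightLT w k (r + 1)) (m : Fin 3 →₀ ℕ) (hr : weight w m + r + l < n) :
    monomial m 1 * g * f ∈ K := by
  refine mul_mem_of_forall_monomial_mul_mem (monomial_mul_mem_weightLT m 1 hg) fun m' hm' => h _ ?_
  omega

lemma monomial_mul_cuspPartial_zero_mem (m : Fin 3 →₀ ℕ) :
    monomial m 1 * cuspPartial c q 0 ∈ cuspSpan d c q := by
  have h := cuspFam_mem_cuspSpan (d := d) (c := c) (q := q) (m := m + (single 1 1 + single 2 1))
    (by simp [cuspStd])
  rwa [cuspFam, if_pos (by simp), add_tsub_cancel_right] at h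

lemma monomial_mul_cuspPartial_one_mem {m : Fin 3 →₀ ℕ} (hm : m 1 = 0) :
    monomial m 1 * cuspPartial c q 1 ∈ cuspSpan d c q := by
  have h := cuspFam_mem_cuspSpan (d := d) (c := c) (q := q) (m := m + (single 0 1 + single 2 1))
    (by simp [cuspStd])
  rwa [cuspFam, if_neg (by simp [hm]), if_pos (by simp), add_tsub_cancel_right] at h

lemma monomial_mul_cuspPartial_two_mem {m : Fin 3 →₀ ℕ} (hm : m 2 = 0) :
    monomial m 1 * cuspPartial c q 2 ∈ cuspSpan d c q := by
  have h := cuspFam_mem_cuspSpan (d := d) (c := c) (q := q) (m := m + (single 0 1 + single 1 1))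
    (by simp [cuspStd])
  rwa [cuspFam, if_neg (by simp [hm]), if_neg (by simp [hm]), if_pos (by simp),
    add_tsub_cancel_right] at h

lemma monomial_mul_eulerDiff_zero_mem {m : Fin 3 →₀ ℕ} (h1 : m 1 = 0) (h2 : m 2 = 0) :
    monomial m 1 * eulerDiff q 0 ∈ cuspSpan d c q := by
  have h := cuspFam_mem_cuspSpan (d := d) (c := c) (q := q) (m := m + single 0 (d 0 + 1))
    (by simp [cuspStd, h1, h2]; omega)
  rwa [cuspFam, if_neg (by simp [h1]), if_neg (by simp [h2]), if_neg (by simp [h1]),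
    if_pos (by simp), add_tsub_cancel_right] at h

lemma monomial_mul_eulerDiff_one_mem {m : Fin 3 →₀ ℕ} (h0 : m 0 = 0) (h2 : m 2 = 0) :
    monomial m 1 * eulerDiff q 1 ∈ cuspSpan d c q := by
  have h := cuspFam_mem_cuspSpan (d := d) (c := c) (q := q) (m := m + single 1 (d 1 + 1))
    (by simp [cuspStd, h0, h2]; omega)
  rwa [cuspFam, if_neg (by simp [h2]), if_neg (by simp [h2]), if_neg (by simp [h0]),
    if_neg (by simp [h0]), if_pos (by simp), add_tsub_cancel_right] at h

lemma monomial_mul_apexRel_mem {m : Fin 3 →₀ ℕ} (h0 : m 0 = 0) (h1 : m 1 = 0) :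
    monomial m 1 * apexRel c q ∈ cuspSpan d c q := by
  have h := cuspFam_mem_cuspSpan (d := d) (c := c) (q := q) (m := m + single 2 (d 2 + 2))
    (by simp [cuspStd, h0, h1])
  rwa [cuspFam, if_neg (by simp [h1]), if_neg (by simp [h0]), if_neg (by simp [h0]),
    if_neg (by simp [h0]), if_neg (by simp [h1]), if_pos (by simp), add_tsub_cancel_right] at h

lemma monomial_mul_mem_of_C_mul {K : Submodule k (MvPolynomial (Fin 3) k)} (hc : c ≠ 0)
    {m : Fin 3 →₀ ℕ} {f p : MvPolynomial (Fin 3) k} (h : monomial m 1 * p ∈ K)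
    (hp : C c * f = p) : monomial m 1 * f ∈ K := by
  have h' := Submodule.smul_mem K c⁻¹ h
  rwa [← hp, smul_eq_C_mul, mul_left_comm, ← mul_assoc (C _) (C _), ← C_mul, inv_mul_cancel₀ hc,
    C_1, one_mul] at h'

/-- `cuspSpan` contains all monomial multiples of the cusp partial derivatives and of the relations
derived from them. -/
lemma mulMemBelow_cuspSpan (hw : CuspWeight d w) (hc : c ≠ 0)
    (hq : ∀ i, HasLead w (q i) (single i (d i))) (n : ℕ) :
    MulMemBelow w (cuspSpan d c q) (cuspPartial c q 1) (w 0 + w 2) n ∧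
    MulMemBelow w (cuspSpan d c q) (cuspPartial c q 2) (w 0 + w 1) n ∧
    MulMemBelow w (cuspSpan d c q) (apexRel c q) ((d 2 + 2) * w 2) n ∧
    MulMemBelow w (cuspSpan d c q) (eulerDiff q 0) ((d 0 + 1) * w 0) n ∧
    MulMemBelow w (cuspSpan d c q) (eulerDiff q 1) ((d 1 + 1) * w 1) n := by
  obtain ⟨hw0, hw1, hws⟩ := hw
  have hqw : ∀ i, q i ∈ weightLT w k (d i * w i + 1) := fun i =>
    (hq i).mem_weightLT (by simp [Finsupp.weight_single])
  have hXq : X 2 * q 2 ∈ weightLT w k ((d 2 + 1) * w 2 + 1) :=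
    (hasLead_X_mul (hq 2)).mem_weightLT (by simp only [Finsupp.weight_single, smul_eq_mul]; omega)
  have hf0 : ∀ g, g * cuspPartial c q 0 ∈ cuspSpan d c q := fun g => by
    induction g using MvPolynomial.induction_on' with
    | monomial m r =>
      have := Submodule.smul_mem _ r (monomial_mul_cuspPartial_zero_mem (d := d) (c := c) (q := q) m)
      rwa [← smul_mul_assoc, smul_monomial, smul_eq_mul, mul_one] at this
    | add p q hp hq => rw [add_mul]; exact add_mem hp hq
  induction n with
  | zero => simp [MulMemBelow]
  | succ n ih =>
    obtain ⟨-, -, -, ihu, ihv⟩ := ih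
    have hf1 : MulMemBelow w (cuspSpan d c q) (cuspPartial c q 1) (w 0 + w 2) (n + 1) := by
      intro m hm
      by_cases h : m 1 = 0
      · exact monomial_mul_cuspPartial_one_mem h
      obtain ⟨m', hm', heq⟩ := monomial_eq_mul_X (k := k) (w := w) h
      have := add_mem (hf0 (monomial m' 1 * X 0)) (sub_mem (ihv m' (by linarith))
        (ihu m' (by linarith)))
      convert this using 1
      rw [heq]; simp [cuspPartial, eulerDiff]; ring
    have hf2 : MulMemBelow w (cuspSpan d c q) (cuspPartial c q 2) (w 0 + w 1) (n + 1) := by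
      intro m hm
      by_cases h : m 2 = 0
      · exact monomial_mul_cuspPartial_two_mem h
      obtain ⟨m', hm', heq⟩ := monomial_eq_mul_X (k := k) (w := w) h
      have := sub_mem (hf0 (monomial m' 1 * X 0)) (ihu m' (by linarith))
      convert this using 1
      rw [heq]; simp [cuspPartial, eulerDiff]; ring
    have ha : MulMemBelow w (cuspSpan d c q) (apexRel c q) ((d 2 + 2) * w 2) (n + 1) := by
      intro m hm
      by_cases h0 : m 0 = 0
      · by_cases h1 : m 1 = 0
        · exact monomial_mul_apexRel_mem h0 h1
        obtain ⟨m', hm', heq⟩ := monomial_eq_mul_X (k := k) (w := w) h1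
        have := add_mem (ihv.monomial_mul_mul_mem (hqw 0) m' (by linarith))
          (hf0 (monomial m' 1 * (X 2 * q 2)))
        convert this using 1
        rw [heq]; simp [cuspPartial, eulerDiff, apexRel]; ring
      obtain ⟨m', hm', heq⟩ := monomial_eq_mul_X (k := k) (w := w) h0
      have := add_mem (ihu.monomial_mul_mul_mem (hqw 1) m' (by linarith))
        (hf1.monomial_mul_mul_mem hXq m' (by linarith))
      convert this using 1
      rw [heq]; simp [cuspPartial, eulerDiff, apexRel]; ring
    refine ⟨hf1, hf2, ha, fun m hm => ?_, fun m hm => ?_⟩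
    · by_cases h1 : m 1 = 0
      · by_cases h2 : m 2 = 0
        · exact monomial_mul_eulerDiff_zero_mem h1 h2
        obtain ⟨m', hm', heq⟩ := monomial_eq_mul_X (k := k) (w := w) h2
        have := sub_mem (ha m' (by linarith)) (hf1.monomial_mul_mul_mem (hqw 0) m' (by linarith))
        rw [heq, mul_assoc]
        rw [mul_assoc, ← mul_sub] at this
        refine monomial_mul_mem_of_C_mul hc this ?_
        simp [cuspPartial, eulerDiff, apexRel]; ring
      obtain ⟨m', hm', heq⟩ := monomial_eq_mul_X (k := k) (w := w) h1
      have := sub_mem (hf0 (monomial m' 1 * q 2)) (hf2.monomial_mul_mul_mem (hqw 0) m' (by linarith))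
      rw [heq, mul_assoc]
      rw [mul_assoc, mul_assoc, ← mul_sub] at this
      refine monomial_mul_mem_of_C_mul hc this ?_
      simp [cuspPartial, eulerDiff]; ring
    · by_cases h0 : m 0 = 0
      · by_cases h2 : m 2 = 0
        · exact monomial_mul_eulerDiff_one_mem h0 h2
        obtain ⟨m', hm', heq⟩ := monomial_eq_mul_X (k := k) (w := w) h2
        have := sub_mem (ha m' (by linarith)) (hf0 (monomial m' 1 * q 1))
        rw [heq, mul_assoc]
        rw [mul_assoc, ← mul_sub] at this
        refine monomial_mul_mem_of_C_mul hc this ?_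
        simp [cuspPartial, eulerDiff, apexRel]; ring
      obtain ⟨m', hm', heq⟩ := monomial_eq_mul_X (k := k) (w := w) h0
      have := sub_mem (hf1.monomial_mul_mul_mem (hqw 2) m' (by linarith))
        (hf2.monomial_mul_mul_mem (hqw 1) m' (by linarith))
      rw [heq, mul_assoc]
      rw [mul_assoc, mul_assoc, ← mul_sub] at this
      refine monomial_mul_mem_of_C_mul hc this ?_
      simp [cuspPartial, eulerDiff]; ring

lemma span_cuspPartial_eq_cuspSpan (hw : CuspWeight d w) (hc : c ≠ 0)
    (hq : ∀ i, HasLead w (q i) (single i (d i))) :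
    (Ideal.span (Set.range (cuspPartial c q))).restrictScalars k = cuspSpan d c q := by
  apply le_antisymm
  · have hmon : ∀ (i : Fin 3) (m : Fin 3 →₀ ℕ),
        monomial m 1 * cuspPartial c q i ∈ cuspSpan d c q := fun i m => by
      fin_cases i
      · exact monomial_mul_cuspPartial_zero_mem m
      · exact (mulMemBelow_cuspSpan hw hc hq _).1 m (Nat.lt_succ_self _)
      · exact (mulMemBelow_cuspSpan hw hc hq _).2.1 m (Nat.lt_succ_self _)
    intro p hp
    rw [Submodule.restrictScalars_mem, Ideal.mem_span_range_iff_exists_fun] at hp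
    obtain ⟨g, rfl⟩ := hp
    exact sum_mem fun i _ => mul_mem_of_forall_monomial_mul_mem (w := w)
      (n := weightedTotalDegree w (g i) + 1)
      ((mem_restrictSupport_iff k).mpr fun m hm => Nat.lt_succ_of_le (le_weightedTotalDegree w hm))
      fun m _ => hmon i m
  · set J := Ideal.span (Set.range (cuspPartial c q))
    have hf : ∀ i, cuspPartial c q i ∈ J := fun i => Ideal.subset_span (Set.mem_range_self i)
    have hu : eulerDiff q 0 ∈ J := by
      have : eulerDiff q 0 = X 0 * cuspPartial c q 0 - X 2 * cuspPartial c q 2 := by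
        simp [cuspPartial, eulerDiff]; ring
      rw [this]
      exact sub_mem (J.mul_mem_left _ (hf 0)) (J.mul_mem_left _ (hf 2))
    have hv : eulerDiff q 1 ∈ J := by
      have : eulerDiff q 1 = X 1 * cuspPartial c q 1 - X 2 * cuspPartial c q 2 := by
        simp [cuspPartial, eulerDiff]; ring
      rw [this]
      exact sub_mem (J.mul_mem_left _ (hf 1)) (J.mul_mem_left _ (hf 2))
    have ha : apexRel c q ∈ J := by
      have : apexRel c q = C c * X 2 * eulerDiff q 0 + q 0 * cuspPartial c q 1 := by
        simp [cuspPartial, eulerDiff, apexRel]; ring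
      rw [this]
      exact add_mem (J.mul_mem_left _ hu) (J.mul_mem_left _ (hf 1))
    rw [cuspSpan, Submodule.span_le]
    rintro _ ⟨m, hm, rfl⟩
    rw [SetLike.mem_coe, Submodule.restrictScalars_mem]
    unfold cuspFam
    split_ifs with c1 c2 c3 c4 c5 c6
    · exact J.mul_mem_left _ (hf 0)
    · exact J.mul_mem_left _ (hf 1)
    · exact J.mul_mem_left _ (hf 2)
    · exact J.mul_mem_left _ hu
    · exact J.mul_mem_left _ hv
    · exact J.mul_mem_left _ ha
    all_goals exact absurd ⟨c1, c2, c3, c4, c5, c6⟩ hm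

end CuspRewriting

end MvPolynomial

lemma LinearIndependent.map_comp_of_ker_eq_span {R V W ι κ : Type*} [Ring R]
    [AddCommGroup V] [AddCommGroup W] [Module R V] [Module R W] {b : ι → V}
    (hli : LinearIndependent R b) (hsp : Submodule.span R (Set.range b) = ⊤) {L : V →ₗ[R] W}
    (hL : Function.Surjective L) {S : Set ι} (hker : LinearMap.ker L = Submodule.span R (b '' Sᶜ))
    {φ : κ → ι} (hφ : Function.Injective φ) (hS : Set.range φ = S) :
    LinearIndependent R (L ∘ b ∘ φ) ∧ Submodule.span R (Set.range (L ∘ b ∘ φ)) = ⊤ := by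
  have hrange : Set.range (b ∘ φ) = b '' S := by rw [Set.range_comp, hS]
  constructor
  · refine (hli.comp φ hφ).map ?_
    rw [hrange, hker]
    rcases subsingleton_or_nontrivial R with _ | _
    · have := Module.subsingleton R V
      exact disjoint_iff.mpr (Subsingleton.elim _ _)
    · exact hli.disjoint_span_image disjoint_compl_right
  · rw [Set.range_comp, hrange, Submodule.span_image, ← LinearMap.range_eq_top.mpr hL,
      LinearMap.range_eq_map, ← hsp, ← Set.image_univ, ← Set.union_compl_self S, Set.image_union,
      Submodule.span_union, Submodule.map_sup, ← hker]
    rw [eq_comm, sup_eq_left, Submodule.map_le_iff_le_comap]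
    intro x hx
    simp [LinearMap.mem_ker.mp hx]

namespace MvPolynomial

lemma cuspFam_of_mem_cuspStd {k : Type*} [Field k] {d : Fin 3 → ℕ} {c : k}
    {q : Fin 3 → MvPolynomial (Fin 3) k} {m : Fin 3 →₀ ℕ} (hm : m ∈ cuspStd d) :
    cuspFam d c q m = if m = single 2 (d 2 + 1) then X 2 * q 2 else monomial m 1 := by
  obtain ⟨h1, h2, h3, h4, h5, h6⟩ := hm
  rw [cuspFam, if_neg h1, if_neg h2, if_neg h3, if_neg h4, if_neg h5, if_neg h6]

/-- The derivative of the part of the cusp unfolding that only involves `x i`. -/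
noncomputable def axisDeriv (a : Fin 3 → ℕ) (sij : Fin 3 → ℕ → ℂ) (i : Fin 3) :
    MvPolynomial (Fin 3) ℂ :=
  monomial (single i (a i - 1)) (a i : ℂ) +
    ∑ j ∈ Finset.Ico 1 (a i), monomial (single i (j - 1)) (sij i j * j)

lemma pderiv_cuspUnfolding (a : Fin 3 → ℕ) (s1 : ℂ) (sij : Fin 3 → ℕ → ℂ) (sμ : ℂ) (i : Fin 3) :
    pderiv i (cuspUnfolding a s1 sij sμ) = cuspPartial sμ⁻¹ (axisDeriv a sij) i := by
  have hpow : ∀ (i l : Fin 3) (n : ℕ) (r : ℂ), pderiv i (C r * X l ^ n) =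
      if l = i then monomial (single i (n - 1)) (r * n) else 0 := by
    intro i l n r
    rw [X_pow_eq_monomial, C_mul_monomial, mul_one]
    split_ifs with h
    · rw [h, pderiv_monomial_single]
    · rw [pderiv_monomial, Finsupp.single_eq_of_ne (Ne.symm h)]
      simp
  have hpow' : ∀ (i l : Fin 3) (n : ℕ), pderiv i (X l ^ n) =
      if l = i then monomial (single i (n - 1)) (n : ℂ) else 0 := fun i l n => by
    simpa using hpow i l n 1
  unfold cuspUnfolding axisDeriv
  simp only [map_add, map_sub, map_sum, hpow, hpow', pderiv_C, pderiv_mul, pderiv_X]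
  fin_cases i <;> simp [cuspPartial] <;> ring

lemma hasLead_axisDeriv {w a : Fin 3 → ℕ} (hw : ∀ i, 0 < w i) (ha : ∀ i, 0 < a i)
    (sij : Fin 3 → ℕ → ℂ) (i : Fin 3) :
    HasLead w (axisDeriv a sij i) (single i (a i - 1)) := by
  refine (hasLead_monomial _ (Nat.cast_ne_zero.mpr (ha i).ne')).add (sum_mem fun j hj => ?_)
  apply monomial_mem_weightLT
  rw [Finset.mem_Ico] at hj
  simp only [Finsupp.weight_single, smul_eq_mul]
  exact Nat.mul_lt_mul_of_pos_right (by omega) (hw i)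

lemma exists_cuspWeight {a : Fin 3 → ℕ} (ha : ∀ i, 0 < a i)
    (hχ : 1 < (1 : ℚ) / (a 0) + 1 / (a 1) + 1 / (a 2)) :
    ∃ w : Fin 3 → ℕ, (∀ i, 0 < w i) ∧ CuspWeight (fun i => a i - 1) w := by
  have h0 := ha 0
  have h1 := ha 1
  have h2 := ha 2
  generalize ha0 : a 0 = x at *
  generalize ha1 : a 1 = y at *
  generalize ha2 : a 2 = z at *
  have hS : x * y * z + 1 ≤ y * z + x * z + x * y := by
    have hx : (0 : ℚ) < x := by exact_mod_cast h0
    have hy : (0 : ℚ) < y := by exact_mod_cast h1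
    have hz : (0 : ℚ) < z := by exact_mod_cast h2
    have h : (x * y * z : ℚ) < y * z + x * z + x * y := by
      have := mul_lt_mul_of_pos_right hχ (mul_pos (mul_pos hx hy) hz)
      field_simp at this
      linarith
    exact_mod_cast h
  set N := x * y * z with hN
  have hN0 : 0 < N := by positivity
  refine ⟨![y * z * (2 * N + 1), x * z * (2 * N + 1), x * y * (2 * N)], ?_, ?_, ?_, ?_⟩
  · intro i
    fin_cases i <;> simp <;> omega
  all_goals
    simp only [Matrix.cons_val_zero, Matrix.cons_val_one, Matrix.cons_val, ha0, ha1, ha2,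
      Nat.sub_add_cancel h0, Nat.sub_add_cancel h1, Nat.sub_add_cancel h2]
  · nlinarith
  · nlinarith
  · have := Nat.mul_le_mul_right (2 * N) hS
    have hyz : 0 < y * z := by positivity
    nlinarith

/-- The exponent of the leading monomial of each member of the family of monomials. -/
noncomputable def muExponent (a : Fin 3 → ℕ) : MuIdx a → (Fin 3 →₀ ℕ)
  | Sum.inl _ => 0
  | Sum.inr (Sum.inl ⟨i, j⟩) => single i (j : ℕ)
  | Sum.inr (Sum.inr _) => single 2 (a 2)

lemma muExponent_injective {a : Fin 3 → ℕ} (ha : ∀ i, 0 < a i) :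
    Function.Injective (muExponent a) := by
  have hpos := ha 2
  rintro (_ | ⟨i, j, hj⟩ | _) (_ | ⟨i', j', hj'⟩ | _) h <;>
    try have hj1 := Finset.mem_Ico.mp hj
  all_goals try have hj2 := Finset.mem_Ico.mp hj'
  all_goals simp only [muExponent] at h
  · rfl
  · simp [eq_comm] at h; omega
  · simp [eq_comm] at h; omega
  · simp at h; omega
  · rcases (Finsupp.single_eq_single_iff _ _ _ _).mp h with ⟨rfl, rfl⟩ | h
    · rfl
    · omega
  · rcases (Finsupp.single_eq_single_iff _ _ _ _).mp h with ⟨rfl, rfl⟩ | h <;> omega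
  · simp at h; omega
  · rcases (Finsupp.single_eq_single_iff _ _ _ _).mp h with ⟨rfl, rfl⟩ | h <;> omega
  · rfl

lemma range_muExponent {a : Fin 3 → ℕ} (ha : ∀ i, 0 < a i) :
    Set.range (muExponent a) = cuspStd fun i => a i - 1 := by
  have h0 := ha 0
  have h1 := ha 1
  have h2 := ha 2
  ext m
  constructor
  · rintro ⟨_ | ⟨i, j, hj⟩ | _, rfl⟩
    · simp [muExponent, cuspStd]
    · rw [Finset.mem_Ico] at hj
      fin_cases i <;> simp [muExponent, cuspStd] at * <;> omega
    · simp [muExponent, cuspStd]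
      omega
  · rintro ⟨m1, m2, m3, m4, m5, m6⟩
    dsimp only at m4 m5 m6
    have hm : ∀ i : Fin 3, (∀ j, j ≠ i → m j = 0) → m = single i (m i) := by
      intro i hi
      ext j
      by_cases h : j = i
      · simp [h]
      · simp [hi j h, h]
    have key : ∀ i : Fin 3, (∀ j, j ≠ i → m j = 0) → m i < a i → m ∈ Set.range (muExponent a) := by
      intro i hi hlt
      by_cases hz : m i = 0
      · refine ⟨Sum.inl (), ?_⟩
        rw [hm i hi, hz, Finsupp.single_zero]; rfl
      · exact ⟨Sum.inr (Sum.inl ⟨i, m i, Finset.mem_Ico.mpr ⟨by omega, hlt⟩⟩), (hm i hi).symm⟩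
    by_cases c0 : m 0 = 0
    · by_cases c1 : m 1 = 0
      · have hi : ∀ j : Fin 3, j ≠ 2 → m j = 0 := fun j hj => by fin_cases j <;> simp_all
        by_cases c2 : m 2 = a 2
        · exact ⟨Sum.inr (Sum.inr ()), by rw [hm 2 hi, c2]; rfl⟩
        · exact key 2 hi (by omega)
      · exact key 1 (fun j hj => by fin_cases j <;> simp at * <;> omega) (by omega)
    · exact key 0 (fun j hj => by fin_cases j <;> simp at * <;> omega) (by omega)

end MvPolynomial

lemma jacobianIdeal_cuspUnfolding (a : Fin 3 → ℕ) (s1 : ℂ) (sij : Fin 3 → ℕ → ℂ) (sμ : ℂ) :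
    jacobianIdeal (cuspUnfolding a s1 sij sμ) =
      Ideal.span (Set.range (cuspPartial sμ⁻¹ (axisDeriv a sij))) := by
  simp only [jacobianIdeal, pderiv_cuspUnfolding]

lemma jacFam_eq_comp_cuspFam {a : Fin 3 → ℕ} (ha : ∀ i, 0 < a i) (s1 : ℂ) (sij : Fin 3 → ℕ → ℂ)
    (sμ : ℂ) :
    jacFam a s1 sij sμ =
      (Ideal.Quotient.mkₐ ℂ (jacobianIdeal (cuspUnfolding a s1 sij sμ))).toLinearMap ∘
        cuspFam (fun i => a i - 1) sμ⁻¹ (axisDeriv a sij) ∘ muExponent a := by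
  funext k
  have hstd : muExponent a k ∈ cuspStd fun i => a i - 1 :=
    range_muExponent ha ▸ Set.mem_range_self k
  have hne : k ≠ Sum.inr (Sum.inr ()) → muExponent a k ≠ single 2 (a 2) := fun hk h =>
    hk (muExponent_injective ha h)
  simp only [Function.comp_apply, cuspFam_of_mem_cuspStd hstd, Nat.sub_add_cancel (ha 2)]
  rcases k with _ | ⟨i, j⟩ | _
  · rw [if_neg (hne (by simp))]
    rfl
  · rw [if_neg (hne (by simp))]
    simp [jacFam, muExponent, X_pow_eq_monomial]
  · rw [if_pos (by rfl)]
    refine Ideal.Quotient.eq.mpr ?_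
    have : C sμ⁻¹ * (X 0 * X 1 * X 2) - X 2 * axisDeriv a sij 2 =
        -X 2 * pderiv 2 (cuspUnfolding a s1 sij sμ) := by
      rw [pderiv_cuspUnfolding]
      simp [cuspPartial]
      ring
    rw [this]
    exact Ideal.mul_mem_left _ _ (Ideal.subset_span (Set.mem_range_self _))

/-- For every choice of parameters, the residue classes of the `μ_A` polynomials `1`, `xᵢʲ`
(`i = 1,2,3`, `1 ≤ j ≤ aᵢ − 1`) and `s_μ⁻¹·x₁x₂x₃` form a `ℂ`-basis of the Jacobian ring. -/
theorem jacFam_isBasis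
    (a : Fin 3 → ℕ) (ha : ∀ i, 0 < a i)
    (hord : a 0 ≤ a 1 ∧ a 1 ≤ a 2)
    (hχ : 1 < (1 : ℚ) / (a 0) + 1 / (a 1) + 1 / (a 2))
    (s1 : ℂ) (sij : Fin 3 → ℕ → ℂ) (sμ : ℂ) (hsμ : sμ ≠ 0) :
    LinearIndependent ℂ (jacFam a s1 sij sμ) ∧
      Submodule.span ℂ (Set.range (jacFam a s1 sij sμ)) = ⊤ := by
  obtain ⟨w, hpos, hw⟩ := exists_cuspWeight ha hχ
  have hc : sμ⁻¹ ≠ 0 := inv_ne_zero hsμ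
  have hq := hasLead_axisDeriv hpos ha sij
  have hlead := hasLead_cuspFam hw hc hq
  rw [jacFam_eq_comp_cuspFam ha]
  refine (linearIndependent_of_hasLead hlead).map_comp_of_ker_eq_span
    (span_eq_top_of_hasLead hlead) (Ideal.Quotient.mkₐ_surjective ℂ _) ?_
    (muExponent_injective ha) (range_muExponent ha)
  change _ = cuspSpan _ _ _
  rw [← span_cuspPartial_eq_cuspSpan hw hc hq, ← jacobianIdeal_cuspUnfolding a s1 sij sμ]
  ext p
  simp [Ideal.Quotient.eq_zero_iff_mem]
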